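/- Theoretical equivalence of the eigenvalue and SDP relaxations: the optimal values coincide, i.e. inf{ θ(u) : u ∈ ℝ^{n+1} } = sup{ trace(−MX) : X a real symmetric positive semidefinite (n+1)×(n+1) matrix with diag(X) = e }, and both the infimum and the supremum are attained. -/

import Mathlib

open Matrix

noncomputable section

/-- The largest eigenvalue of a real (symmetric) matrix, i.e. the supremum of its spectrum. -/
def lamMax {k : Type*} [Fintype k] [DecidableEq k] (S : Matrix k k ℝ) : ℝ :=
  sSup (spectrum ℝ S)

/-- The block matrix `M = [[AᵀA + νP, −Aᵀy], [−yᵀA, yᵀy]]`, acting on `ℝ^{n+1} = ℝ^n ⊕ ℝ`. -/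
def Mmat {m n : ℕ} (A : Matrix (Fin m) (Fin n) ℝ) (y : Fin m → ℝ) (ν : ℝ)
    (P : Matrix (Fin n) (Fin n) ℝ) : Matrix (Fin n ⊕ Unit) (Fin n ⊕ Unit) ℝ :=
  Matrix.fromBlocks (Aᵀ * A + ν • P)
    (Matrix.of fun i (_ : Unit) => -(Aᵀ *ᵥ y) i)
    (Matrix.of fun (_ : Unit) j => -(Aᵀ *ᵥ y) j)
    (Matrix.of fun _ _ => y ⬝ᵥ y)

/-- The matrix `A(u) = D(u) − M − (uᵀe/(n+1))·I`. -/
def Amat {m n : ℕ} (A : Matrix (Fin m) (Fin n) ℝ) (y : Fin m → ℝ) (ν : ℝ)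
    (P : Matrix (Fin n) (Fin n) ℝ) (u : Fin n ⊕ Unit → ℝ) :
    Matrix (Fin n ⊕ Unit) (Fin n ⊕ Unit) ℝ :=
  Matrix.diagonal u - Mmat A y ν P - ((u ⬝ᵥ (fun _ => 1)) / (n + 1 : ℝ)) • 1

/-- The dual function `θ(u) = (n+1)·λmax(A(u))`. -/
def theta {m n : ℕ} (A : Matrix (Fin m) (Fin n) ℝ) (y : Fin m → ℝ) (ν : ℝ)
    (P : Matrix (Fin n) (Fin n) ℝ) (u : Fin n ⊕ Unit → ℝ) : ℝ :=
  (n + 1 : ℝ) * lamMax (Amat A y ν P u)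

/-- The set of values `−xᵀMx` over binary vectors `x ∈ {−1,1}^{n+1}`;
its supremum (a maximum) is `opt(BLS)`. -/
def BLSvals {n : ℕ} (M : Matrix (Fin n ⊕ Unit) (Fin n ⊕ Unit) ℝ) : Set ℝ :=
  {t | ∃ x : Fin n ⊕ Unit → ℝ, (∀ i, x i = 1 ∨ x i = -1) ∧ t = -(x ⬝ᵥ (M *ᵥ x))}

open scoped MatrixOrder in
theorem Matrix.PosSemidef.trace_mul_nonneg {k : Type*} [Fintype k] {S X : Matrix k k ℝ}
    (hS : S.PosSemidef) (hX : X.PosSemidef) : 0 ≤ (S * X).trace := by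
  have h := (hS.hadamard hX.transpose).dotProduct_mulVec_nonneg (fun _ => 1)
  simpa [dotProduct, mulVec, trace, mul_apply] using h

open scoped Pointwise in
theorem Matrix.posSemidef_smul_one_sub_iff {k : Type*} [Fintype k] [DecidableEq k]
    {S : Matrix k k ℝ} (hS : S.IsHermitian) (c : ℝ) :
    (c • 1 - S).PosSemidef ↔ ∀ μ ∈ spectrum ℝ S, μ ≤ c := by
  have hspec : spectrum ℝ (c • 1 - S) = ({c} : Set ℝ) - spectrum ℝ S := by
    rw [spectrum.singleton_sub_eq, Algebra.algebraMap_eq_smul_one]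
  have hherm : (c • 1 - S).IsHermitian := by
    refine IsHermitian.sub ?_ hS
    simp [IsHermitian]
  rw [posSemidef_iff_isHermitian_and_spectrum_nonneg, hspec, and_iff_right hherm]
  simp [Set.subset_def]

theorem lamMax_le_iff {k : Type*} [Fintype k] [DecidableEq k] [Nonempty k]
    {S : Matrix k k ℝ} (hS : S.IsHermitian) (c : ℝ) :
    lamMax S ≤ c ↔ (c • 1 - S).PosSemidef := by
  have hne : (spectrum ℝ S).Nonempty :=
    ⟨_, hS.eigenvalues_mem_spectrum_real (Classical.arbitrary k)⟩
  rw [posSemidef_smul_one_sub_iff hS, lamMax, csSup_le_iff S.finite_real_spectrum.bddAbove hne]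

theorem Matrix.isCompact_setOf_posSemidef_diag_eq_one {k : Type*} [Fintype k] [DecidableEq k] :
    IsCompact {X : Matrix k k ℝ | X.PosSemidef ∧ ∀ i, X.diag i = 1} := by
  have hcpt : IsCompact {X : Matrix k k ℝ | ∀ i j, X i j ∈ Set.Icc (-1 : ℝ) 1} := by
    have := isCompact_univ_pi fun _ : k => isCompact_univ_pi fun _ : k =>
      (isCompact_Icc : IsCompact (Set.Icc (-1 : ℝ) 1))
    simp only [Set.pi, Set.mem_univ, true_imp_iff] at this
    exact this
  refine hcpt.of_isClosed_subset ?_ ?_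
  · simp only [posSemidef_iff_dotProduct_mulVec, IsHermitian, Set.ofPred_and, Set.ofPred_forall]
    refine ((isClosed_eq (by fun_prop) (by fun_prop)).inter
      (isClosed_iInter fun x => isClosed_le (by fun_prop) (by fun_prop))).inter
      (isClosed_iInter fun i => isClosed_eq (by unfold Matrix.diag; fun_prop) (by fun_prop))
  · rintro X ⟨hX, hd⟩ i j
    have hs : X j i = X i j := by simpa using hX.1.apply i j
    have hi : X i i = 1 := hd i
    have hj : X j j = 1 := hd j
    have h₁ := hX.dotProduct_mulVec_nonneg (Pi.single i 1 + Pi.single j 1)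
    have h₂ := hX.dotProduct_mulVec_nonneg (Pi.single i 1 - Pi.single j 1)
    simp [mulVec_add, mulVec_sub, hi, hj, hs] at h₁ h₂
    constructor <;> linarith

/-- Strong duality for the max-cut type SDP, with an attained dual: any upper bound `v` on
`trace (C * X)` over the elliptope is certified by a diagonal matrix dominating `C`. -/
theorem exists_diagonal_sub_posSemidef {k : Type*} [Fintype k] [DecidableEq k]
    {C : Matrix k k ℝ} (hC : C.IsHermitian) {v : ℝ}
    (hv : ∀ X : Matrix k k ℝ, X.PosSemidef → (∀ i, X.diag i = 1) → (C * X).trace ≤ v) :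
    ∃ w : k → ℝ, ∑ i, w i ≤ v ∧ (diagonal w - C).PosSemidef := by
  let Q : Set ((k → ℝ) × ℝ) :=
    {p | ∃ X : Matrix k k ℝ, X.PosSemidef ∧ X.diag = p.1 ∧ p.2 ≤ (C * X).trace}
  have hconv : Convex ℝ Q := by
    rintro p ⟨X, hX, hXd, hXt⟩ q ⟨Y, hY, hYd, hYt⟩ a b ha hb -
    refine ⟨a • X + b • Y, (hX.smul ha).add (hY.smul hb), ?_, ?_⟩
    · simp [diag_add, diag_smul, hXd, hYd]
    · simp only [Prod.snd_add, Prod.smul_snd, smul_eq_mul, mul_add, trace_add, Matrix.mul_smul,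
        trace_smul]
      gcongr
  have hint : (interior Q).Nonempty := by
    let U : Set ((k → ℝ) × ℝ) := {p | (∀ i, 0 < p.1 i) ∧ p.2 < (C * diagonal p.1).trace}
    have hU : IsOpen U := by
      simp only [U, Set.ofPred_and, Set.ofPred_forall]
      exact (isOpen_iInter_of_finite fun i => isOpen_lt (by fun_prop) (by fun_prop)).inter
        (isOpen_lt (by fun_prop) (by fun_prop))
    have hUQ : U ⊆ Q := fun p hp =>
      ⟨diagonal p.1, PosSemidef.diagonal fun i => (hp.1 i).le, diag_diagonal _, hp.2.le⟩
    exact ⟨(fun _ => 1, (C * diagonal fun _ => 1).trace - 1),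
      interior_maximal hUQ hU ⟨by simp, by simp⟩⟩
  have hnot : ((fun _ => 1, v) : (k → ℝ) × ℝ) ∉ interior Q := by
    intro h
    have hcont : ContinuousAt (fun ε : ℝ => ((fun _ => 1, v + ε) : (k → ℝ) × ℝ)) 0 := by fun_prop
    have hev := hcont.eventually_mem (by simpa using mem_interior_iff_mem_nhds.1 h)
    obtain ⟨ε, ⟨X, hX, hd, ht⟩, hε⟩ :=
      ((hev.filter_mono nhdsWithin_le_nhds).and
        (self_mem_nhdsWithin : Set.Ioi (0 : ℝ) ∈ nhdsWithin 0 (Set.Ioi 0))).exists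
    have hle : v + ε ≤ v := ht.trans (hv X hX fun i => congrFun hd i)
    linarith
  obtain ⟨f, hf0, hfQ⟩ := geometric_hahn_banach_of_nonempty_interior_point hconv hnot hint
  set τ := f (0, 1) with hτ
  set ω : k → ℝ := fun i => -f (Pi.single i 1, 0) with hω
  have hf (d : k → ℝ) (t : ℝ) : f (d, t) = t * τ - ∑ i, d i * ω i := by
    have h₁ : f (d, 0) = ∑ i, d i * f (Pi.single i 1, 0) := by
      have := (f.toLinearMap ∘ₗ LinearMap.inl ℝ (k → ℝ) ℝ).pi_apply_eq_sum_univ d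
      have he (i : k) : (fun j => if i = j then (1 : ℝ) else 0) = Pi.single i 1 := by
        ext j; simp [Pi.single_apply, eq_comm]
      simpa [he] using this
    have h₂ : f (0, t) = t * τ := by
      rw [hτ, ← smul_eq_mul, ← map_smul]; simp
    have h₃ : f (d, t) = f (d, 0) + f (0, t) := by rw [← map_add]; simp
    simp [h₃, h₁, h₂, hω]; ring
  have hcone (d : k → ℝ) (t : ℝ) (h : (d, t) ∈ Q) : f (d, t) ≤ 0 := by
    obtain ⟨X, hX, hd, ht⟩ := h
    by_contra! hpos
    obtain ⟨N, hN⟩ := exists_nat_gt (f (fun _ => 1, v) / f (d, t))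
    have hmem : ((N : ℝ) • (d, t)) ∈ Q := by
      refine ⟨(N : ℝ) • X, hX.smul (by positivity), ?_, ?_⟩
      · simpa [diag_smul] using congrArg ((N : ℝ) • ·) hd
      · simp only [Prod.smul_snd, smul_eq_mul, Matrix.mul_smul, trace_smul]
        gcongr
    have := hfQ _ hmem
    rw [map_smul, smul_eq_mul] at this
    rw [div_lt_iff₀ hpos] at hN
    linarith
  have hsum : ∑ i, ω i ≤ v * τ := by
    have := hfQ 0 ⟨0, .zero, by simp, by simp⟩
    simp only [map_zero] at this
    simp only [hf, one_mul] at this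
    linarith
  have hX (X : Matrix k k ℝ) (hX : X.PosSemidef) : (C * X).trace * τ ≤ ∑ i, X i i * ω i := by
    have := hcone X.diag (C * X).trace ⟨X, hX, rfl, le_rfl⟩
    simp only [hf, diag_apply] at this
    linarith
  have hτ0 : 0 ≤ τ := by
    have := hcone 0 (-1) ⟨0, .zero, by simp, by simp⟩
    simp [hf] at this
    linarith
  have hτpos : 0 < τ := by
    refine hτ0.lt_of_ne fun h0 => hf0 ?_
    rw [← h0] at hX hsum
    have hω0 (i : k) : 0 ≤ ω i := by
      have := hX (diagonal (Pi.single i 1)) (.diagonal (by simp))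
      simpa [Pi.single_apply] using this
    have hωz := (Finset.sum_eq_zero_iff_of_nonneg fun i _ => hω0 i).1
      (le_antisymm (by simpa using hsum) (Finset.sum_nonneg fun i _ => hω0 i))
    ext p
    · simp [hf, ← h0, hωz]
    · simp [hf, ← h0]
  refine ⟨fun i => ω i / τ, ?_, ?_⟩
  · rw [← Finset.sum_div, div_le_iff₀ hτpos]
    exact hsum
  · refine .of_dotProduct_mulVec_nonneg ((isHermitian_diagonal _).sub hC) fun x => ?_
    have h := hX (vecMulVec x (star x)) (posSemidef_vecMulVec_self_star x)
    rw [mul_vecMulVec, trace_vecMulVec, ← le_div_iff₀ hτpos, Finset.sum_div] at h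
    have hd : star x ⬝ᵥ (diagonal (fun i => ω i / τ) *ᵥ x)
        = ∑ i, vecMulVec x (star x) i i * ω i / τ := by
      simp only [dotProduct, mulVec_diagonal, vecMulVec_apply]
      exact Finset.sum_congr rfl fun i _ => by ring
    rw [sub_mulVec, dotProduct_sub, hd, dotProduct_comm _ (C *ᵥ x)]
    linarith

theorem Mmat_isHermitian {m n : ℕ} (A : Matrix (Fin m) (Fin n) ℝ) (y : Fin m → ℝ) (ν : ℝ)
    {P : Matrix (Fin n) (Fin n) ℝ} (hP : P.IsSymm) : (Mmat A y ν P).IsHermitian := by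
  refine IsHermitian.fromBlocks ?_ ?_ ?_
  · simp [IsHermitian, hP.eq, conjTranspose_eq_transpose_of_trivial]
  · ext; simp
  · ext; simp

theorem Amat_isHermitian {m n : ℕ} (A : Matrix (Fin m) (Fin n) ℝ) (y : Fin m → ℝ) (ν : ℝ)
    {P : Matrix (Fin n) (Fin n) ℝ} (hP : P.IsSymm) (u : Fin n ⊕ Unit → ℝ) :
    (Amat A y ν P u).IsHermitian := by
  refine ((isHermitian_diagonal u).sub (Mmat_isHermitian A y ν hP)).sub ?_
  simp [IsHermitian]

/-- Weak duality. -/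
theorem trace_neg_Mmat_mul_le_theta {m n : ℕ} (A : Matrix (Fin m) (Fin n) ℝ) (y : Fin m → ℝ)
    (ν : ℝ) {P : Matrix (Fin n) (Fin n) ℝ} (hP : P.IsSymm) (u : Fin n ⊕ Unit → ℝ)
    {X : Matrix (Fin n ⊕ Unit) (Fin n ⊕ Unit) ℝ} (hX : X.PosSemidef) (hd : ∀ i, X.diag i = 1) :
    ((-(Mmat A y ν P)) * X).trace ≤ theta A y ν P u := by
  have h := ((lamMax_le_iff (Amat_isHermitian A y ν hP u) _).1 le_rfl).trace_mul_nonneg hX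
  have htr : X.trace = n + 1 := by
    simp only [trace, hd]; simp
  have hdu : (diagonal u * X).trace = u ⬝ᵥ fun _ => 1 := by
    simp only [diag_apply] at hd
    simp [trace, dotProduct, diagonal_mul, hd]
  rw [theta]
  generalize lamMax (Amat A y ν P u) = l at h ⊢
  have hn : (n + 1 : ℝ) ≠ 0 := by positivity
  simp only [Amat, sub_mul, smul_mul, one_mul, trace_sub, trace_smul, smul_eq_mul, htr, hdu,
    div_mul_cancel₀ _ hn] at h
  rw [neg_mul, trace_neg]
  linarith

/-- A diagonal matrix dominating `-M` yields a point at which `θ` is at most its trace. -/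
theorem theta_neg_le_sum {m n : ℕ} (A : Matrix (Fin m) (Fin n) ℝ) (y : Fin m → ℝ)
    (ν : ℝ) {P : Matrix (Fin n) (Fin n) ℝ} (hP : P.IsSymm) {w : Fin n ⊕ Unit → ℝ}
    (hw : (diagonal w - -(Mmat A y ν P)).PosSemidef) : theta A y ν P (-w) ≤ ∑ i, w i := by
  have hn : (0 : ℝ) < n + 1 := by positivity
  rw [theta, ← le_div_iff₀' hn, lamMax_le_iff (Amat_isHermitian A y ν hP _)]
  convert hw using 1
  have hs : (-w) ⬝ᵥ (fun _ => 1) = -∑ i, w i := by simp [dotProduct]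
  have hneg : diagonal (-w) = -diagonal w := (diagonal_neg w).symm
  rw [Amat, hs, hneg]
  module

/-- Theoretical equivalence of the eigenvalue and SDP relaxations: there is a
common value `v` which is the (attained) minimum of `θ` over `ℝ^{n+1}` and the (attained)
maximum of `trace(−MX)` over feasible SDP matrices. -/
theorem eigenvalue_eq_sdp_relaxation {m n : ℕ} (A : Matrix (Fin m) (Fin n) ℝ)
    (y : Fin m → ℝ) (ν : ℝ) (hν : 0 ≤ ν) (P : Matrix (Fin n) (Fin n) ℝ) (hP : P.IsSymm) :
    ∃ v : ℝ,
      IsLeast (Set.range (theta A y ν P)) v ∧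
      IsGreatest
        {t | ∃ X : Matrix (Fin n ⊕ Unit) (Fin n ⊕ Unit) ℝ,
          X.PosSemidef ∧ (∀ i, X.diag i = 1) ∧ t = ((-(Mmat A y ν P)) * X).trace} v := by
  obtain ⟨X, ⟨hX, hd⟩, hmax⟩ :=
    (isCompact_setOf_posSemidef_diag_eq_one (k := Fin n ⊕ Unit)).exists_isMaxOn
      ⟨1, .one, by simp⟩
      (f := fun X => ((-(Mmat A y ν P)) * X).trace) (by fun_prop)
  obtain ⟨w, hwv, hw⟩ := exists_diagonal_sub_posSemidef (Mmat_isHermitian A y ν hP).neg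
    fun Y hY hYd => hmax ⟨hY, hYd⟩
  refine ⟨_, ⟨⟨-w, ?_⟩, ?_⟩, ⟨X, hX, hd, rfl⟩, ?_⟩
  · exact le_antisymm ((theta_neg_le_sum A y ν hP hw).trans hwv)
      (trace_neg_Mmat_mul_le_theta A y ν hP _ hX hd)
  · rintro _ ⟨u, rfl⟩
    exact trace_neg_Mmat_mul_le_theta A y ν hP u hX hd
  · rintro _ ⟨Y, hY, hYd, rfl⟩
    exact hmax ⟨hY, hYd⟩
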